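/- arXiv:1312.1389 — 5 statements merged into one kernel-verified Lean document; each statement's English description precedes it below -/
import Mathlib

section
/- (Combined velocity–angular-velocity estimate, inequality (3.8) in the proof of Proposition 3.1.) For every 0 ≤ k ≤ K−1 one has (‖u^{k+1}‖² − ‖u^k‖²) + ‖𝔡u^{k+1}‖² + (𝔧 + 4ν_rτ)(‖w^{k+1}‖² − ‖w^k‖²) + (𝔧 + 2ν_rτ)‖𝔡w^{k+1}‖² + 2τ(ν‖Gu^{k+1}‖² + c₁‖Gw^{k+1}‖² + c₂‖d w^{k+1}‖²) + 2τ⟨∇p♯_k, u^{k+1}⟩ ≤ 2τ(⟨f^{k+1}, u^{k+1}⟩ + ⟨g^{k+1}, w^{k+1}⟩ − ⟨∇𝔡ψ^{k+1}, u^{k+1}⟩), where the coefficients 𝔧 + 4ν_rτ and 𝔧 + 2ν_rτ are the ones produced by the absorption of the curl coupling terms in the proof. -/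
open scoped RealInnerProductSpace

/-- Polarization of the backward difference tested against the new value. -/
theorem inner_sub_self_right_eq_norm_sq {F : Type*} [NormedAddCommGroup F] [InnerProductSpace ℝ F]
    (x y : F) : ⟪x - y, x⟫ = (‖x‖ ^ 2 - ‖y‖ ^ 2 + ‖x - y‖ ^ 2) / 2 := by
  rw [norm_sub_sq_real, inner_sub_left, real_inner_self_eq_norm_sq, real_inner_comm]
  ring

/-- **Combined velocity–angular-velocity estimate**, inequality (3.8) in the proof of
Proposition 3.1. -/
theorem combined_velocity_angular_estimate
    {H E S : Type*}
    [NormedAddCommGroup H] [InnerProductSpace ℝ H]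
    [NormedAddCommGroup E] [InnerProductSpace ℝ E]
    [NormedAddCommGroup S] [InnerProductSpace ℝ S]
    (V : Submodule ℝ H) (M : Submodule ℝ S)
    [FiniteDimensional ℝ V] [FiniteDimensional ℝ M]
    (G : V →ₗ[ℝ] E) (r : V →ₗ[ℝ] H) (d : V →ₗ[ℝ] S) (grd : M →ₗ[ℝ] H)
    (b : V →ₗ[ℝ] V →ₗ[ℝ] V →ₗ[ℝ] ℝ)
    (hb : ∀ x y : V, b x y y = 0)
    (𝔧 ν νr c₁ c₂ ν₀ τ : ℝ)
    (h𝔧 : 0 < 𝔧) (hν : 0 < ν) (hνr : 0 < νr) (hc₁ : 0 < c₁) (hc₂ : 0 < c₂)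
    (hν₀ : ν₀ = ν + νr) (hτ : 0 < τ)
    (K : ℕ)
    (u w : ℕ → V) (p ψ : ℕ → M) (f g : ℕ → H)
    (ps : ℕ → M)
    (hps0 : ps 0 = p 0)
    (hpsk : ∀ k, 1 ≤ k → ps k = (2 : ℝ) • p k - p (k - 1))
    (hvel : ∀ k < K, ∀ v : V,
      (1 / τ) * ⟪u (k + 1) - u k, v⟫ + b (u k) (u (k + 1)) v
          + ν₀ * ⟪G (u (k + 1)), G v⟫ + ⟪grd (ps k), (v : H)⟫
        = 2 * νr * ⟪r (w k), (v : H)⟫ + ⟪f (k + 1), (v : H)⟫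
          - ⟪grd (ψ (k + 1) - ψ k), (v : H)⟫)
    (hpres : ∀ k < K, ∀ q : M,
      ⟪grd (p (k + 1) - p k), grd q⟫
        = (1 / τ) * ⟪(u (k + 1) : H), grd q⟫ + ⟪grd (ψ (k + 1)), grd q⟫)
    (hang : ∀ k < K, ∀ z : V,
      𝔧 * ((1 / τ) * ⟪w (k + 1) - w k, z⟫) + 𝔧 * b (u (k + 1)) (w (k + 1)) z
          + c₁ * ⟪G (w (k + 1)), G z⟫ + c₂ * ⟪d (w (k + 1)), d z⟫
          + 4 * νr * ⟪w (k + 1), z⟫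
        = 2 * νr * ⟪r (u (k + 1)), (z : H)⟫ + ⟪g (k + 1), (z : H)⟫)
    (hrsym : ∀ v z : V, ⟪r v, (z : H)⟫ = ⟪(v : H), r z⟫)
    (hrd : ∀ v : V, ‖r v‖ ^ 2 + ‖d v‖ ^ 2 ≤ ‖G v‖ ^ 2) :
    ∀ k < K,
      (‖u (k + 1)‖ ^ 2 - ‖u k‖ ^ 2) + ‖u (k + 1) - u k‖ ^ 2
          + (𝔧 + 4 * νr * τ) * (‖w (k + 1)‖ ^ 2 - ‖w k‖ ^ 2)
          + (𝔧 + 2 * νr * τ) * ‖w (k + 1) - w k‖ ^ 2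
          + 2 * τ * (ν * ‖G (u (k + 1))‖ ^ 2 + c₁ * ‖G (w (k + 1))‖ ^ 2
              + c₂ * ‖d (w (k + 1))‖ ^ 2)
          + 2 * τ * ⟪grd (ps k), (u (k + 1) : H)⟫
        ≤ 2 * τ * (⟪f (k + 1), (u (k + 1) : H)⟫ + ⟪g (k + 1), (w (k + 1) : H)⟫
            - ⟪grd (ψ (k + 1) - ψ k), (u (k + 1) : H)⟫) := by
  intro k hk
  have hu := hvel k hk (u (k + 1))
  have hw := hang k hk (w (k + 1))
  have hsym := hrsym (w k) (u (k + 1))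
  have hcomm : ⟪(w k : H), r (u (k + 1))⟫ = ⟪r (u (k + 1)), (w k : H)⟫ := real_inner_comm _ _
  have hcurl := hrd (u (k + 1))
  have hyoung : 0 ≤ ‖r (u (k + 1)) - ((w k : H) + w (k + 1))‖ ^ 2 := by positivity
  have hsum : ‖(w k : H) + w (k + 1)‖ ^ 2
      = 2 * ‖w k‖ ^ 2 + 2 * ‖w (k + 1)‖ ^ 2 - ‖w (k + 1) - w k‖ ^ 2 := by
    rw [norm_add_sq_real, norm_sub_sq_real, Submodule.coe_inner, real_inner_comm (w k : H),
      Submodule.coe_norm, Submodule.coe_norm]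
    ring
  rw [norm_sub_sq_real, hsum, inner_add_right] at hyoung
  rw [hb, inner_sub_self_right_eq_norm_sq, real_inner_self_eq_norm_sq] at hu
  rw [hb, inner_sub_self_right_eq_norm_sq, real_inner_self_eq_norm_sq, real_inner_self_eq_norm_sq,
    real_inner_self_eq_norm_sq] at hw
  rw [hsym, hcomm, hν₀] at hu
  have habsorb : 0 ≤ 2 * νr * τ * (‖G (u (k + 1))‖ ^ 2
      - 2 * (⟪r (u (k + 1)), (w k : H)⟫ + ⟪r (u (k + 1)), (w (k + 1) : H)⟫)
      + (2 * ‖w k‖ ^ 2 + 2 * ‖w (k + 1)‖ ^ 2 - ‖w (k + 1) - w k‖ ^ 2)) := by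
    apply mul_nonneg (by positivity)
    nlinarith [sq_nonneg ‖d (u (k + 1))‖]
  field_simp at hu hw
  linarith
end

section
/- (Second-increment pressure bound, inequality (3.10) in the proof of Proposition 3.1.) For every 1 ≤ k ≤ K−1 one has τ²‖∇𝔡²p^{k+1}‖² ≤ ‖𝔡u^{k+1}‖² + τ²‖∇𝔡ψ^{k+1}‖² + 2τ⟨𝔡u^{k+1}, ∇𝔡ψ^{k+1}⟩. (Obtained by taking the difference of the pressure updates at steps k+1 and k, testing with q = 2τ𝔡²p^{k+1}, and applying the Cauchy–Schwarz inequality.) -/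
open scoped RealInnerProductSpace

/-- If `⟪y, y⟫ = ⟪x, y⟫`, then `y` is no longer than `x`, by Cauchy–Schwarz. -/
theorem norm_le_norm_of_inner_self_eq_inner {F : Type*} [NormedAddCommGroup F]
    [InnerProductSpace ℝ F] {x y : F} (h : ⟪y, y⟫ = ⟪x, y⟫) : ‖y‖ ≤ ‖x‖ := by
  have hcs := real_inner_le_norm x y
  rw [← h, real_inner_self_eq_norm_mul_norm] at hcs
  rcases (norm_nonneg y).eq_or_lt with hy | hy
  · rw [← hy]
    exact norm_nonneg x
  · exact le_of_mul_le_mul_right hcs hy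

/-- **Second-increment pressure bound**, inequality (3.10) in the proof of Proposition 3.1. -/
theorem second_increment_pressure_bound
    {H E S : Type*}
    [NormedAddCommGroup H] [InnerProductSpace ℝ H]
    [NormedAddCommGroup E] [InnerProductSpace ℝ E]
    [NormedAddCommGroup S] [InnerProductSpace ℝ S]
    (V : Submodule ℝ H) (M : Submodule ℝ S)
    [FiniteDimensional ℝ V] [FiniteDimensional ℝ M]
    (G : V →ₗ[ℝ] E) (r : V →ₗ[ℝ] H) (d : V →ₗ[ℝ] S) (grd : M →ₗ[ℝ] H)
    (b : V →ₗ[ℝ] V →ₗ[ℝ] V →ₗ[ℝ] ℝ)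
    (hb : ∀ x y : V, b x y y = 0)
    (𝔧 ν νr c₁ c₂ ν₀ τ : ℝ)
    (h𝔧 : 0 < 𝔧) (hν : 0 < ν) (hνr : 0 < νr) (hc₁ : 0 < c₁) (hc₂ : 0 < c₂)
    (hν₀ : ν₀ = ν + νr) (hτ : 0 < τ)
    (K : ℕ)
    (u w : ℕ → V) (p ψ : ℕ → M) (f g : ℕ → H)
    (ps : ℕ → M)
    (hps0 : ps 0 = p 0)
    (hpsk : ∀ k, 1 ≤ k → ps k = (2 : ℝ) • p k - p (k - 1))
    (hvel : ∀ k < K, ∀ v : V,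
      (1 / τ) * ⟪u (k + 1) - u k, v⟫ + b (u k) (u (k + 1)) v
          + ν₀ * ⟪G (u (k + 1)), G v⟫ + ⟪grd (ps k), (v : H)⟫
        = 2 * νr * ⟪r (w k), (v : H)⟫ + ⟪f (k + 1), (v : H)⟫
          - ⟪grd (ψ (k + 1) - ψ k), (v : H)⟫)
    (hpres : ∀ k < K, ∀ q : M,
      ⟪grd (p (k + 1) - p k), grd q⟫
        = (1 / τ) * ⟪(u (k + 1) : H), grd q⟫ + ⟪grd (ψ (k + 1)), grd q⟫)
    (hang : ∀ k < K, ∀ z : V,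
      𝔧 * ((1 / τ) * ⟪w (k + 1) - w k, z⟫) + 𝔧 * b (u (k + 1)) (w (k + 1)) z
          + c₁ * ⟪G (w (k + 1)), G z⟫ + c₂ * ⟪d (w (k + 1)), d z⟫
          + 4 * νr * ⟪w (k + 1), z⟫
        = 2 * νr * ⟪r (u (k + 1)), (z : H)⟫ + ⟪g (k + 1), (z : H)⟫) :
    ∀ k, 1 ≤ k → k < K →
      τ ^ 2 * ‖grd (p (k + 1) - (2 : ℝ) • p k + p (k - 1))‖ ^ 2
        ≤ ‖u (k + 1) - u k‖ ^ 2 + τ ^ 2 * ‖grd (ψ (k + 1) - ψ k)‖ ^ 2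
          + 2 * τ * ⟪((u (k + 1) - u k : V) : H), grd (ψ (k + 1) - ψ k)⟫ := by
  intro k hk hkK
  set a : M := p (k + 1) - (2 : ℝ) • p k + p (k - 1) with ha
  set x : H := ((u (k + 1) - u k : V) : H) + τ • grd (ψ (k + 1) - ψ k) with hx
  have hnext := hpres k hkK a
  have hprev := hpres (k - 1) (by omega) a
  rw [Nat.sub_add_cancel hk] at hprev
  have hsplit : a = (p (k + 1) - p k) - (p k - p (k - 1)) := by
    rw [ha, two_smul]
    abel
  have hself : ⟪grd a, grd a⟫
      = (1 / τ) * ⟪((u (k + 1) - u k : V) : H), grd a⟫ + ⟪grd (ψ (k + 1) - ψ k), grd a⟫ := by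
    calc ⟪grd a, grd a⟫
        = ⟪grd (p (k + 1) - p k), grd a⟫ - ⟪grd (p k - p (k - 1)), grd a⟫ := by
          rw [← inner_sub_left, ← map_sub, ← hsplit]
      _ = _ := by
          rw [hnext, hprev, Submodule.coe_sub, map_sub, inner_sub_left, inner_sub_left]
          ring
  have hle : ‖τ • grd a‖ ≤ ‖x‖ := by
    apply norm_le_norm_of_inner_self_eq_inner
    rw [hx, inner_add_left]
    simp only [real_inner_smul_left, real_inner_smul_right]
    rw [hself]
    field_simp
  calc τ ^ 2 * ‖grd a‖ ^ 2 = ‖τ • grd a‖ ^ 2 := by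
        rw [norm_smul, mul_pow, Real.norm_eq_abs, sq_abs]
    _ ≤ ‖x‖ ^ 2 := by gcongr
    _ = _ := by
        rw [hx, norm_add_sq_real, norm_smul, mul_pow, Real.norm_eq_abs, sq_abs,
          real_inner_smul_right, Submodule.coe_norm]
        ring
end

section
/- (Proposition 3.1: a priori estimate on the velocities, estimate (3.7).) For every 1 ≤ k ≤ K−1 one has (‖u^{k+1}‖² − ‖u^k‖²) + (𝔧 + 4ν_rτ)(‖w^{k+1}‖² − ‖w^k‖²) + 𝔧‖𝔡w^{k+1}‖² + 2τ(ν‖Gu^{k+1}‖² + c₁‖Gw^{k+1}‖² + c₂‖d w^{k+1}‖²) + τ²(‖∇p^{k+1}‖² − ‖∇p^k‖² + ‖∇𝔡p^k‖²) ≤ 2τ(⟨f^{k+1}, u^{k+1}⟩ + ⟨g^{k+1}, w^{k+1}⟩ − ⟨∇𝔡ψ^{k+1}, u^k⟩ + τ⟨∇ψ^{k+1}, ∇p♯_k⟩) + τ²‖∇𝔡ψ^{k+1}‖². (This is estimate (3.7) of the paper, with the coefficient 𝔧 + 4ν_rτ on the angular-velocity difference term and the final ψ-increment term as produced by adding the intermediate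 estimates (3.8)–(3.10) of its proof; the right-hand side depends only on the data and on the solution at previous time steps, so this is an a priori estimate.) -/
open scoped RealInnerProductSpace

/-- If `x` is orthogonal to `x - y`, then `x` is no longer than `y`. -/
theorem norm_sq_le_norm_sq_of_inner_self_eq {H : Type*} [NormedAddCommGroup H]
    [InnerProductSpace ℝ H] {x y : H} (h : ⟪x, x⟫ = ⟪y, x⟫) : ‖x‖ ^ 2 ≤ ‖y‖ ^ 2 := by
  have h1 := norm_sub_sq_real y x
  rw [← h, real_inner_self_eq_norm_sq] at h1
  nlinarith [sq_nonneg ‖y - x‖]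

/-- The polarized telescoping identity for the extrapolation `2 b - a` of `a, b` towards `c`. -/
theorem two_mul_inner_sub_extrapolation {H : Type*} [NormedAddCommGroup H]
    [InnerProductSpace ℝ H] (a b c : H) :
    2 * ⟪c - b, (2 : ℝ) • b - a⟫
      = ‖c‖ ^ 2 - ‖b‖ ^ 2 + ‖b - a‖ ^ 2 - ‖(c - b) - (b - a)‖ ^ 2 := by
  simp only [← real_inner_self_eq_norm_sq, inner_sub_left, inner_sub_right, inner_smul_right]
  rw [real_inner_comm b a, real_inner_comm c a, real_inner_comm c b]
  ring

/-- The polarized telescoping identity for a first-order increment. -/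
theorem two_mul_inner_sub_self {H : Type*} [NormedAddCommGroup H]
    [InnerProductSpace ℝ H] (a b : H) :
    2 * ⟪b - a, b⟫ = ‖b‖ ^ 2 - ‖a‖ ^ 2 + ‖b - a‖ ^ 2 := by
  simp only [← real_inner_self_eq_norm_sq, inner_sub_left, inner_sub_right]
  rw [real_inner_comm b a]
  ring

/-- Young's inequality for a vector paired with a sum. -/
theorem two_mul_inner_add_le {H : Type*} [NormedAddCommGroup H]
    [InnerProductSpace ℝ H] (a b c : H) :
    2 * (⟪a, c⟫ + ⟪b, c⟫) ≤ ‖c‖ ^ 2 + 2 * ‖a‖ ^ 2 + 2 * ‖b‖ ^ 2 := by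
  have h1 := norm_sub_sq_real (a + b) c
  have h2 := parallelogram_law_with_norm ℝ a b
  rw [inner_add_left] at h1
  nlinarith [sq_nonneg ‖a + b - c‖, sq_nonneg ‖a - b‖]

/-- **Proposition 3.1: a priori estimate on the velocities**, estimate (3.7). -/
theorem apriori_estimate_velocities
    {H E S : Type*}
    [NormedAddCommGroup H] [InnerProductSpace ℝ H]
    [NormedAddCommGroup E] [InnerProductSpace ℝ E]
    [NormedAddCommGroup S] [InnerProductSpace ℝ S]
    (V : Submodule ℝ H) (M : Submodule ℝ S)
    [FiniteDimensional ℝ V] [FiniteDimensional ℝ M]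
    (G : V →ₗ[ℝ] E) (r : V →ₗ[ℝ] H) (d : V →ₗ[ℝ] S) (grd : M →ₗ[ℝ] H)
    (b : V →ₗ[ℝ] V →ₗ[ℝ] V →ₗ[ℝ] ℝ)
    (hb : ∀ x y : V, b x y y = 0)
    (𝔧 ν νr c₁ c₂ ν₀ τ : ℝ)
    (h𝔧 : 0 < 𝔧) (hν : 0 < ν) (hνr : 0 < νr) (hc₁ : 0 < c₁) (hc₂ : 0 < c₂)
    (hν₀ : ν₀ = ν + νr) (hτ : 0 < τ)
    (K : ℕ)
    (u w : ℕ → V) (p ψ : ℕ → M) (f g : ℕ → H)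
    (ps : ℕ → M)
    (hps0 : ps 0 = p 0)
    (hpsk : ∀ k, 1 ≤ k → ps k = (2 : ℝ) • p k - p (k - 1))
    (hvel : ∀ k < K, ∀ v : V,
      (1 / τ) * ⟪u (k + 1) - u k, v⟫ + b (u k) (u (k + 1)) v
          + ν₀ * ⟪G (u (k + 1)), G v⟫ + ⟪grd (ps k), (v : H)⟫
        = 2 * νr * ⟪r (w k), (v : H)⟫ + ⟪f (k + 1), (v : H)⟫
          - ⟪grd (ψ (k + 1) - ψ k), (v : H)⟫)
    (hpres : ∀ k < K, ∀ q : M,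
      ⟪grd (p (k + 1) - p k), grd q⟫
        = (1 / τ) * ⟪(u (k + 1) : H), grd q⟫ + ⟪grd (ψ (k + 1)), grd q⟫)
    (hang : ∀ k < K, ∀ z : V,
      𝔧 * ((1 / τ) * ⟪w (k + 1) - w k, z⟫) + 𝔧 * b (u (k + 1)) (w (k + 1)) z
          + c₁ * ⟪G (w (k + 1)), G z⟫ + c₂ * ⟪d (w (k + 1)), d z⟫
          + 4 * νr * ⟪w (k + 1), z⟫
        = 2 * νr * ⟪r (u (k + 1)), (z : H)⟫ + ⟪g (k + 1), (z : H)⟫)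
    (hrsym : ∀ v z : V, ⟪r v, (z : H)⟫ = ⟪(v : H), r z⟫)
    (hrd : ∀ v : V, ‖r v‖ ^ 2 + ‖d v‖ ^ 2 ≤ ‖G v‖ ^ 2) :
    ∀ k, 1 ≤ k → k < K →
      (‖u (k + 1)‖ ^ 2 - ‖u k‖ ^ 2)
          + (𝔧 + 4 * νr * τ) * (‖w (k + 1)‖ ^ 2 - ‖w k‖ ^ 2)
          + 𝔧 * ‖w (k + 1) - w k‖ ^ 2
          + 2 * τ * (ν * ‖G (u (k + 1))‖ ^ 2 + c₁ * ‖G (w (k + 1))‖ ^ 2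
              + c₂ * ‖d (w (k + 1))‖ ^ 2)
          + τ ^ 2 * (‖grd (p (k + 1))‖ ^ 2 - ‖grd (p k)‖ ^ 2
              + ‖grd (p k - p (k - 1))‖ ^ 2)
        ≤ 2 * τ * (⟪f (k + 1), (u (k + 1) : H)⟫ + ⟪g (k + 1), (w (k + 1) : H)⟫
              - ⟪grd (ψ (k + 1) - ψ k), (u k : H)⟫
              + τ * ⟪grd (ψ (k + 1)), grd (ps k)⟫)
          + τ ^ 2 * ‖grd (ψ (k + 1) - ψ k)‖ ^ 2 := by
  intro k hk1 hkK
  obtain ⟨m, rfl⟩ : ∃ m, k = m + 1 := ⟨k - 1, by omega⟩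
  have hps := hpsk (m + 1) hk1
  simp only [Nat.add_sub_cancel] at hps ⊢
  have hv := hvel (m + 1) hkK (u (m + 1 + 1))
  have ha := hang (m + 1) hkK (w (m + 1 + 1))
  have hq := hpres (m + 1) hkK (ps (m + 1))
  rw [hb] at hv ha
  have hproj : τ ^ 2 * ‖grd (p (m + 1 + 1) - p (m + 1)) - grd (p (m + 1) - p m)‖ ^ 2
      ≤ ‖u (m + 1 + 1) - u (m + 1)‖ ^ 2
        + 2 * τ * ⟪grd (ψ (m + 1 + 1) - ψ (m + 1)), ((u (m + 1 + 1) : H) - u (m + 1))⟫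
        + τ ^ 2 * ‖grd (ψ (m + 1 + 1) - ψ (m + 1))‖ ^ 2 := by
    set q := (p (m + 1 + 1) - p (m + 1)) - (p (m + 1) - p m) with hqdef
    have e1 := hpres (m + 1) hkK q
    have e0 := hpres m (by omega) q
    have hgq : grd (p (m + 1 + 1) - p (m + 1)) - grd (p (m + 1) - p m) = grd q := by
      rw [hqdef, map_sub grd (p (m + 1 + 1) - p (m + 1))]
    have hdiff : ⟪grd q, grd q⟫ = (1 / τ) * ⟪(u (m + 1 + 1) : H) - u (m + 1), grd q⟫
        + ⟪grd (ψ (m + 1 + 1) - ψ (m + 1)), grd q⟫ := by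
      nth_rewrite 1 [← hgq]
      rw [inner_sub_left, e1, e0, map_sub grd (ψ _), inner_sub_left, inner_sub_left]
      ring
    have horth : ⟪τ • grd q, τ • grd q⟫
        = ⟪((u (m + 1 + 1) : H) - u (m + 1)) + τ • grd (ψ (m + 1 + 1) - ψ (m + 1)),
            τ • grd q⟫ := by
      simp only [inner_smul_right, inner_add_left, real_inner_smul_left]
      rw [hdiff]
      field_simp
    have hle := norm_sq_le_norm_sq_of_inner_self_eq horth
    rw [norm_add_sq_real, norm_smul, norm_smul, mul_pow, mul_pow, Real.norm_eq_abs, sq_abs,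
      inner_smul_right, real_inner_comm] at hle
    rw [hgq]
    have hco : ‖u (m + 1 + 1) - u (m + 1)‖ = ‖(u (m + 1 + 1) : H) - u (m + 1)‖ := rfl
    rw [hco]
    linarith
  have hext := two_mul_inner_sub_extrapolation (grd (p m)) (grd (p (m + 1)))
    (grd (p (m + 1 + 1)))
  simp only [← map_sub grd, ← map_smul grd, ← hps] at hext
  rw [map_sub grd (p (m + 1 + 1) - p (m + 1))] at hext
  have hu := two_mul_inner_sub_self (u (m + 1)) (u (m + 1 + 1))
  have hw := two_mul_inner_sub_self (w (m + 1)) (w (m + 1 + 1))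
  have hyoung := two_mul_inner_add_le (w (m + 1) : H) (w (m + 1 + 1)) (r (u (m + 1 + 1)))
  rw [← hrsym, real_inner_comm (r (u (m + 1 + 1)))] at hyoung
  rw [inner_sub_right] at hproj
  rw [real_inner_comm (grd (ps (m + 1))) (u (m + 1 + 1) : H)] at hq
  simp only [real_inner_self_eq_norm_sq] at hv ha
  simp only [Submodule.norm_coe] at hyoung
  have hinv : τ * (1 / τ) = 1 := by field_simp
  have hy := mul_le_mul_of_nonneg_left hyoung (by positivity : 0 ≤ 2 * τ * νr)
  have hc : 2 * τ * νr * ‖r (u (m + 1 + 1))‖ ^ 2 ≤ 2 * τ * νr * ‖G (u (m + 1 + 1))‖ ^ 2 :=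
    mul_le_mul_of_nonneg_left (by linarith [hrd (u (m + 1 + 1)), sq_nonneg ‖d (u (m + 1 + 1))‖]) (by positivity)
  subst hν₀
  linear_combination 2 * τ * hv + 2 * τ * ha + 2 * τ ^ 2 * hq
    - 2 * ⟪u (m + 1 + 1) - u (m + 1), u (m + 1 + 1)⟫ * hinv
    - 2 * 𝔧 * ⟪w (m + 1 + 1) - w (m + 1), w (m + 1 + 1)⟫ * hinv
    + 2 * τ * ⟪grd (ps (m + 1)), (u (m + 1 + 1) : H)⟫ * hinv
    - hu - 𝔧 * hw - τ ^ 2 * hext + hproj + hy + hc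
end

section
/- (Per-step inf-sup bound on the extrapolated pressure, the key step in the proof of Proposition 3.3.) For every 0 ≤ k ≤ K−1 one has β‖p♯_k‖ ≤ (C_P/τ)‖𝔡u^{k+1}‖ + ν₀‖Gu^{k+1}‖ + 2ν_r‖w^k‖ + ‖f^{k+1}‖_{−1} + ‖𝔡ψ^{k+1}‖ + 𝔦‖u^k‖‖Gu^{k+1}‖. (Obtained from the velocity update by bounding each term of ⟨∇p♯_k, v⟩/‖Gv‖ and invoking the discrete inf-sup condition.) -/
open scoped RealInnerProductSpace

/-- The discrete dual norm `‖φ‖₋₁ = sup { ⟪φ, v⟫ / ‖G v‖ : 0 ≠ v ∈ V }`. -/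
noncomputable def dualNorm {H E : Type*} [NormedAddCommGroup H] [InnerProductSpace ℝ H]
    [NormedAddCommGroup E] [InnerProductSpace ℝ E]
    (V : Submodule ℝ H) (G : V →ₗ[ℝ] E) (φ : H) : ℝ :=
  sSup {x : ℝ | ∃ v : V, v ≠ 0 ∧ x = ⟪φ, (v : H)⟫ / ‖G v‖}

section DualNorm

variable {H E : Type*} [NormedAddCommGroup H] [InnerProductSpace ℝ H]
  [NormedAddCommGroup E] [InnerProductSpace ℝ E]
  {V : Submodule ℝ H} {G : V →ₗ[ℝ] E}

theorem dualNorm_nonneg (φ : H) : 0 ≤ dualNorm V G φ := by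
  rcases Set.eq_empty_or_nonempty {x : ℝ | ∃ v : V, v ≠ 0 ∧ x = ⟪φ, (v : H)⟫ / ‖G v‖} with h | h
  · rw [dualNorm, h, Real.sSup_empty]
  · obtain ⟨_, v, hv, -⟩ := h
    refine Real.sSup_nonneg' ?_
    rcases le_total 0 ⟪φ, (v : H)⟫ with h0 | h0
    · exact ⟨_, ⟨v, hv, rfl⟩, by positivity⟩
    · refine ⟨_, ⟨-v, neg_ne_zero.2 hv, rfl⟩, ?_⟩
      rw [Submodule.coe_neg, inner_neg_right]
      exact div_nonneg (neg_nonneg.2 h0) (norm_nonneg _)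

theorem norm_map_pos_of_poincare {C : ℝ} (hP : ∀ v : V, ‖v‖ ≤ C * ‖G v‖) {v : V} (hv : v ≠ 0) :
    0 < ‖G v‖ := by
  refine (norm_nonneg _).lt_of_ne' fun h => ?_
  have := hP v
  rw [h, mul_zero] at this
  exact this.not_gt (norm_pos_iff.2 hv)

theorem inner_le_dualNorm_mul {C : ℝ} (hP : ∀ v : V, ‖v‖ ≤ C * ‖G v‖) (φ : H) {v : V}
    (hv : v ≠ 0) : ⟪φ, (v : H)⟫ ≤ dualNorm V G φ * ‖G v‖ := by
  rw [← div_le_iff₀ (norm_map_pos_of_poincare hP hv)]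
  refine le_csSup ⟨‖φ‖ * C, ?_⟩ ⟨v, hv, rfl⟩
  rintro _ ⟨z, hz, rfl⟩
  rw [div_le_iff₀ (norm_map_pos_of_poincare hP hz), mul_assoc]
  exact (real_inner_le_norm _ _).trans (mul_le_mul_of_nonneg_left (hP z) (norm_nonneg _))

theorem dualNorm_le_of_inner_le {C : ℝ} (hP : ∀ v : V, ‖v‖ ≤ C * ‖G v‖) {φ : H} {R : ℝ}
    (hR : 0 ≤ R) (h : ∀ v : V, v ≠ 0 → ⟪φ, (v : H)⟫ ≤ R * ‖G v‖) : dualNorm V G φ ≤ R := by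
  refine Real.sSup_le ?_ hR
  rintro _ ⟨v, hv, rfl⟩
  exact (div_le_iff₀ (norm_map_pos_of_poincare hP hv)).2 (h v hv)

end DualNorm

/-- **Per-step inf-sup bound on the extrapolated pressure**, the key step in the proof of
Proposition 3.3. -/
theorem perstep_infsup_pressure_bound
    {H E S : Type*}
    [NormedAddCommGroup H] [InnerProductSpace ℝ H]
    [NormedAddCommGroup E] [InnerProductSpace ℝ E]
    [NormedAddCommGroup S] [InnerProductSpace ℝ S]
    (V : Submodule ℝ H) (M : Submodule ℝ S)
    [FiniteDimensional ℝ V] [FiniteDimensional ℝ M]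
    (G : V →ₗ[ℝ] E) (r : V →ₗ[ℝ] H) (d : V →ₗ[ℝ] S) (grd : M →ₗ[ℝ] H)
    (b : V →ₗ[ℝ] V →ₗ[ℝ] V →ₗ[ℝ] ℝ)
    (hb : ∀ x y : V, b x y y = 0)
    (𝔧 ν νr c₁ c₂ ν₀ τ : ℝ)
    (h𝔧 : 0 < 𝔧) (hν : 0 < ν) (hνr : 0 < νr) (hc₁ : 0 < c₁) (hc₂ : 0 < c₂)
    (hν₀ : ν₀ = ν + νr) (hτ : 0 < τ)
    (K : ℕ)
    (u w : ℕ → V) (p ψ : ℕ → M) (f g : ℕ → H)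
    (ps : ℕ → M)
    (hps0 : ps 0 = p 0)
    (hpsk : ∀ k, 1 ≤ k → ps k = (2 : ℝ) • p k - p (k - 1))
    (hvel : ∀ k < K, ∀ v : V,
      (1 / τ) * ⟪u (k + 1) - u k, v⟫ + b (u k) (u (k + 1)) v
          + ν₀ * ⟪G (u (k + 1)), G v⟫ + ⟪grd (ps k), (v : H)⟫
        = 2 * νr * ⟪r (w k), (v : H)⟫ + ⟪f (k + 1), (v : H)⟫
          - ⟪grd (ψ (k + 1) - ψ k), (v : H)⟫)
    (hpres : ∀ k < K, ∀ q : M,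
      ⟪grd (p (k + 1) - p k), grd q⟫
        = (1 / τ) * ⟪(u (k + 1) : H), grd q⟫ + ⟪grd (ψ (k + 1)), grd q⟫)
    (hang : ∀ k < K, ∀ z : V,
      𝔧 * ((1 / τ) * ⟪w (k + 1) - w k, z⟫) + 𝔧 * b (u (k + 1)) (w (k + 1)) z
          + c₁ * ⟪G (w (k + 1)), G z⟫ + c₂ * ⟪d (w (k + 1)), d z⟫
          + 4 * νr * ⟪w (k + 1), z⟫
        = 2 * νr * ⟪r (u (k + 1)), (z : H)⟫ + ⟪g (k + 1), (z : H)⟫)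
    (hrsym : ∀ v z : V, ⟪r v, (z : H)⟫ = ⟪(v : H), r z⟫)
    (hrd : ∀ v : V, ‖r v‖ ^ 2 + ‖d v‖ ^ 2 ≤ ‖G v‖ ^ 2)
    (β : ℝ) (hβ : 0 < β)
    (hLBB : ∀ q : M, β * ‖q‖ ≤ dualNorm V G (grd q))
    (hibp : ∀ (q : M) (v : V), ⟪grd q, (v : H)⟫ = -⟪(q : S), d v⟫)
    (𝔦 : ℝ) (h𝔦 : 0 < 𝔦)
    (hbB : ∀ x y z : V, b x y z ≤ 𝔦 * ‖x‖ * ‖G y‖ * ‖G z‖)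
    (CP : ℝ) (hCP : 0 < CP)
    (hP : ∀ v : V, ‖v‖ ≤ CP * ‖G v‖) :
    ∀ k < K,
      β * ‖ps k‖
        ≤ (CP / τ) * ‖u (k + 1) - u k‖ + ν₀ * ‖G (u (k + 1))‖ + 2 * νr * ‖w k‖
          + dualNorm V G (f (k + 1)) + ‖ψ (k + 1) - ψ k‖
          + 𝔦 * ‖u k‖ * ‖G (u (k + 1))‖ := by
  intro k hk
  have hν₀_pos : 0 < ν₀ := by rw [hν₀]; positivity
  have hf_nonneg : 0 ≤ dualNorm V G (f (k + 1)) := dualNorm_nonneg _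
  refine (hLBB (ps k)).trans (dualNorm_le_of_inner_le hP (by positivity) fun v hv => ?_)
  have hr : ‖r v‖ ≤ ‖G v‖ :=
    (sq_le_sq₀ (norm_nonneg _) (norm_nonneg _)).1 (by nlinarith [hrd v, sq_nonneg ‖d v‖])
  have hd : ‖d v‖ ≤ ‖G v‖ :=
    (sq_le_sq₀ (norm_nonneg _) (norm_nonneg _)).1 (by nlinarith [hrd v, sq_nonneg ‖r v‖])
  have time_term : -((1 / τ) * ⟪u (k + 1) - u k, v⟫)
      ≤ (CP / τ) * ‖u (k + 1) - u k‖ * ‖G v‖ := by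
    calc -((1 / τ) * ⟪u (k + 1) - u k, v⟫)
        = (1 / τ) * -⟪u (k + 1) - u k, v⟫ := by ring
      _ ≤ (1 / τ) * (‖u (k + 1) - u k‖ * (CP * ‖G v‖)) := by
          gcongr
          exact (neg_le_abs _).trans ((abs_real_inner_le_norm _ _).trans
            (mul_le_mul_of_nonneg_left (hP v) (norm_nonneg _)))
      _ = (CP / τ) * ‖u (k + 1) - u k‖ * ‖G v‖ := by ring
  have convection_term : -b (u k) (u (k + 1)) v ≤ 𝔦 * ‖u k‖ * ‖G (u (k + 1))‖ * ‖G v‖ := by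
    simpa using hbB (u k) (u (k + 1)) (-v)
  have viscous_term : -(ν₀ * ⟪G (u (k + 1)), G v⟫) ≤ ν₀ * ‖G (u (k + 1))‖ * ‖G v‖ := by
    rw [← mul_neg, mul_assoc]
    gcongr
    exact (neg_le_abs _).trans (abs_real_inner_le_norm _ _)
  have curl_term : 2 * νr * ⟪r (w k), (v : H)⟫ ≤ 2 * νr * ‖w k‖ * ‖G v‖ := by
    rw [hrsym, mul_assoc _ ‖w k‖]
    gcongr
    exact (real_inner_le_norm _ _).trans (mul_le_mul_of_nonneg_left hr (norm_nonneg _))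
  have force_term := inner_le_dualNorm_mul hP (f (k + 1)) hv
  have potential_term : -⟪grd (ψ (k + 1) - ψ k), (v : H)⟫ ≤ ‖ψ (k + 1) - ψ k‖ * ‖G v‖ := by
    rw [hibp, neg_neg]
    exact (real_inner_le_norm _ _).trans (mul_le_mul_of_nonneg_left hd (norm_nonneg _))
  linarith [hvel k hk v]
end

section
/- (Proposition 3.3: a priori estimate on the pressure, estimate (3.15).) There exists a constant C, depending only on β, ν₀, ν_r and C_P (and in particular independent of τ, K, 𝔦 and of the subspaces V and M), such that τ Σ_{k=0}^{K−1} ‖p♯_k‖² ≤ C( (1/τ) Σ_{k=1}^{K} ‖𝔡u^k‖² + τ Σ_{k=1}^{K} ‖Gu^k‖² + τ Σ_{k=0}^{K} ‖Gw^k‖² + τ Σ_{k=1}^{K} ‖f^k‖_{−1}² + τ Σ_{k=1}^{K} ‖𝔡ψ^k‖² + τ 𝔦² Σ_{k=0}^{K−1} ‖u^k‖² ‖Gu^{k+1}‖² ). -/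
open scoped RealInnerProductSpace

universe u₁ u₂ u₃

theorem inner_le_dualNorm_mul_s8 {H E : Type*} [NormedAddCommGroup H] [InnerProductSpace ℝ H]
    [NormedAddCommGroup E] [InnerProductSpace ℝ E] {V : Submodule ℝ H} {G : V →ₗ[ℝ] E} {c : ℝ}
    (hG : ∀ v : V, ‖v‖ ≤ c * ‖G v‖) (φ : H) (v : V) :
    ⟪φ, (v : H)⟫ ≤ dualNorm V G φ * ‖G v‖ := by
  have hpos : ∀ v : V, v ≠ 0 → 0 < ‖G v‖ := by
    intro v hv
    refine norm_pos_iff.2 fun h => hv ?_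
    have := hG v
    rw [h, norm_zero, mul_zero] at this
    exact norm_le_zero_iff.1 this
  by_cases hv : v = 0
  · simp [hv]
  rw [← div_le_iff₀ (hpos v hv)]
  refine le_csSup ⟨‖φ‖ * c, ?_⟩ ⟨v, hv, rfl⟩
  rintro x ⟨z, hz, rfl⟩
  rw [div_le_iff₀ (hpos z hz), mul_assoc]
  exact (real_inner_le_norm _ _).trans (mul_le_mul_of_nonneg_left (hG z) (norm_nonneg φ))

theorem dualNorm_le {H E : Type*} [NormedAddCommGroup H] [InnerProductSpace ℝ H]
    [NormedAddCommGroup E] [InnerProductSpace ℝ E] {V : Submodule ℝ H} {G : V →ₗ[ℝ] E} {φ : H}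
    {a : ℝ} (ha : 0 ≤ a) (h : ∀ v : V, ⟪φ, (v : H)⟫ ≤ a * ‖G v‖) : dualNorm V G φ ≤ a := by
  refine Real.sSup_le ?_ ha
  rintro x ⟨v, -, rfl⟩
  exact div_le_of_le_mul₀ (norm_nonneg _) ha (h v)

theorem dualNorm_nonneg_s8 {H E : Type*} [NormedAddCommGroup H] [InnerProductSpace ℝ H]
    [NormedAddCommGroup E] [InnerProductSpace ℝ E] {V : Submodule ℝ H} {G : V →ₗ[ℝ] E} {c : ℝ}
    (hG : ∀ v : V, ‖v‖ ≤ c * ‖G v‖) (φ : H) : 0 ≤ dualNorm V G φ := by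
  by_contra! hlt
  have hzero : ∀ v : V, G v = 0 := by
    intro v
    have h₁ := inner_le_dualNorm_mul_s8 hG φ v
    have h₂ := inner_le_dualNorm_mul_s8 hG φ (-v)
    simp only [map_neg, norm_neg, Submodule.coe_neg, inner_neg_right] at h₂
    exact norm_le_zero_iff.1 (by nlinarith [norm_nonneg (G v)])
  refine hlt.not_ge (Real.sSup_nonneg ?_)
  rintro x ⟨v, -, rfl⟩
  simp [hzero v]

theorem Finset.sum_Icc_one_eq_sum_range {α : Type*} [AddCommMonoid α] (F : ℕ → α) (K : ℕ) :
    ∑ k ∈ Finset.Icc 1 K, F k = ∑ k ∈ Finset.range K, F (k + 1) := by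
  rw [Finset.range_eq_Ico, Finset.sum_Ico_add' F 0 K 1]
  rfl

theorem sq_sum_six_weighted_le {m n l x₁ x₂ x₃ x₄ x₅ x₆ : ℝ} :
    (m * x₁ + n * x₂ + l * x₃ + x₄ + x₅ + x₆) ^ 2
      ≤ 6 * (m ^ 2 + n ^ 2 + l ^ 2 + 1)
        * (x₁ ^ 2 + x₂ ^ 2 + x₃ ^ 2 + x₄ ^ 2 + x₅ ^ 2 + x₆ ^ 2) := by
  have hcs : (m * x₁ + n * x₂ + l * x₃ + 1 * x₄ + 1 * x₅ + 1 * x₆) ^ 2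
      ≤ (m ^ 2 + n ^ 2 + l ^ 2 + 1 ^ 2 + 1 ^ 2 + 1 ^ 2)
        * (x₁ ^ 2 + x₂ ^ 2 + x₃ ^ 2 + x₄ ^ 2 + x₅ ^ 2 + x₆ ^ 2) := by
    simpa [Fin.sum_univ_succ, add_assoc] using
      Finset.sum_mul_sq_le_sq_mul_sq Finset.univ ![m, n, l, 1, 1, 1] ![x₁, x₂, x₃, x₄, x₅, x₆]
  have hle : m ^ 2 + n ^ 2 + l ^ 2 + 1 ^ 2 + 1 ^ 2 + 1 ^ 2
      ≤ 6 * (m ^ 2 + n ^ 2 + l ^ 2 + 1) := by nlinarith [sq_nonneg m, sq_nonneg n, sq_nonneg l]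
  have := hcs.trans (mul_le_mul_of_nonneg_right hle (by positivity))
  simpa only [one_mul] using this

/-- **Proposition 3.3: a priori estimate on the pressure**, estimate (3.15).  There is a
constant `C`, depending only on `β, ν₀, ν_r, C_P` (in particular independent of `τ`, `K`,
`𝔦` and of the discrete spaces `V`, `M`), bounding `τ Σ_{k=0}^{K-1} ‖p♯_k‖²` by the stated
quantities. -/
theorem apriori_estimate_pressure
    (β ν₀ νr CP : ℝ)
    (hβ : 0 < β) (hνr : 0 < νr) (hCP : 0 < CP) :
    ∃ C : ℝ, 0 < C ∧
      ∀ (H : Type u₁) (E : Type u₂) (S : Type u₃)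
        [NormedAddCommGroup H] [InnerProductSpace ℝ H]
        [NormedAddCommGroup E] [InnerProductSpace ℝ E]
        [NormedAddCommGroup S] [InnerProductSpace ℝ S]
        (V : Submodule ℝ H) (M : Submodule ℝ S)
        [FiniteDimensional ℝ V] [FiniteDimensional ℝ M]
        (G : V →ₗ[ℝ] E) (r : V →ₗ[ℝ] H) (d : V →ₗ[ℝ] S) (grd : M →ₗ[ℝ] H)
        (b : V →ₗ[ℝ] V →ₗ[ℝ] V →ₗ[ℝ] ℝ)
        (𝔧 ν c₁ c₂ τ 𝔦 : ℝ),
        0 < 𝔧 → 0 < ν → 0 < c₁ → 0 < c₂ → ν₀ = ν + νr → 0 < τ → 0 < 𝔦 →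
        ∀ (K : ℕ) (u w : ℕ → V) (p ψ : ℕ → M) (f g : ℕ → H) (ps : ℕ → M),
        (∀ x y : V, b x y y = 0) →
        ps 0 = p 0 →
        (∀ k, 1 ≤ k → ps k = (2 : ℝ) • p k - p (k - 1)) →
        (∀ k < K, ∀ v : V,
          (1 / τ) * ⟪u (k + 1) - u k, v⟫ + b (u k) (u (k + 1)) v
              + ν₀ * ⟪G (u (k + 1)), G v⟫ + ⟪grd (ps k), (v : H)⟫
            = 2 * νr * ⟪r (w k), (v : H)⟫ + ⟪f (k + 1), (v : H)⟫
              - ⟪grd (ψ (k + 1) - ψ k), (v : H)⟫) →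
        (∀ k < K, ∀ q : M,
          ⟪grd (p (k + 1) - p k), grd q⟫
            = (1 / τ) * ⟪(u (k + 1) : H), grd q⟫ + ⟪grd (ψ (k + 1)), grd q⟫) →
        (∀ k < K, ∀ z : V,
          𝔧 * ((1 / τ) * ⟪w (k + 1) - w k, z⟫) + 𝔧 * b (u (k + 1)) (w (k + 1)) z
              + c₁ * ⟪G (w (k + 1)), G z⟫ + c₂ * ⟪d (w (k + 1)), d z⟫
              + 4 * νr * ⟪w (k + 1), z⟫
            = 2 * νr * ⟪r (u (k + 1)), (z : H)⟫ + ⟪g (k + 1), (z : H)⟫) →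
        (∀ v z : V, ⟪r v, (z : H)⟫ = ⟪(v : H), r z⟫) →
        (∀ v : V, ‖r v‖ ^ 2 + ‖d v‖ ^ 2 ≤ ‖G v‖ ^ 2) →
        (∀ v : V, ‖v‖ ≤ CP * ‖G v‖) →
        (∀ q : M, β * ‖q‖ ≤ dualNorm V G (grd q)) →
        (∀ (q : M) (v : V), ⟪grd q, (v : H)⟫ = -⟪(q : S), d v⟫) →
        (∀ x y z : V, b x y z ≤ 𝔦 * ‖x‖ * ‖G y‖ * ‖G z‖) →
        τ * ∑ k ∈ Finset.range K, ‖ps k‖ ^ 2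
          ≤ C * ((1 / τ) * ∑ k ∈ Finset.Icc 1 K, ‖u k - u (k - 1)‖ ^ 2
              + τ * ∑ k ∈ Finset.Icc 1 K, ‖G (u k)‖ ^ 2
              + τ * ∑ k ∈ Finset.Icc 0 K, ‖G (w k)‖ ^ 2
              + τ * ∑ k ∈ Finset.Icc 1 K, dualNorm V G (f k) ^ 2
              + τ * ∑ k ∈ Finset.Icc 1 K, ‖ψ k - ψ (k - 1)‖ ^ 2
              + τ * 𝔦 ^ 2 * ∑ k ∈ Finset.range K, ‖u k‖ ^ 2 * ‖G (u (k + 1))‖ ^ 2) := by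
  refine ⟨6 * (CP ^ 2 + ν₀ ^ 2 + (2 * νr * CP) ^ 2 + 1) / β ^ 2, by positivity, ?_⟩
  intro H E S _ _ _ _ _ _ V M _ _ G r d grd b 𝔧 ν c₁ c₂ τ 𝔦 _ hν _ _ hν₀ hτ hi K u w p ψ f g ps
    _ _ _ hu _ _ hcurl hrd hP hLBB hibp hb
  have hν₀_pos : 0 < ν₀ := by linarith
  have hr : ∀ v : V, ‖r v‖ ≤ ‖G v‖ := fun v =>
    (sq_le_sq₀ (norm_nonneg _) (norm_nonneg _)).1 (by nlinarith [hrd v, sq_nonneg ‖d v‖])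
  have hd : ∀ v : V, ‖d v‖ ≤ ‖G v‖ := fun v =>
    (sq_le_sq₀ (norm_nonneg _) (norm_nonneg _)).1 (by nlinarith [hrd v, sq_nonneg ‖r v‖])
  have hbound : ∀ k < K, β * ‖ps k‖ ≤
      CP * ((1 / τ) * ‖u (k + 1) - u k‖) + ν₀ * ‖G (u (k + 1))‖ + (2 * νr * CP) * ‖G (w k)‖
        + dualNorm V G (f (k + 1)) + ‖ψ (k + 1) - ψ k‖ + 𝔦 * ‖u k‖ * ‖G (u (k + 1))‖ := by
    intro k hk
    have hf_nonneg := dualNorm_nonneg_s8 hP (f (k + 1))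
    refine (hLBB (ps k)).trans (dualNorm_le (by positivity) fun v => ?_)
    have hvel := hu k hk v
    have htime : -((1 / τ) * ⟪u (k + 1) - u k, v⟫)
        ≤ (1 / τ) * (‖u (k + 1) - u k‖ * (CP * ‖G v‖)) := by
      rw [← mul_neg]
      refine mul_le_mul_of_nonneg_left ?_ (by positivity)
      refine (neg_le_abs _).trans ((abs_real_inner_le_norm _ _).trans ?_)
      exact mul_le_mul_of_nonneg_left (hP v) (norm_nonneg _)
    have hconv := hb (u k) (u (k + 1)) (-v)
    simp only [map_neg, norm_neg] at hconv
    have hvisc : -(ν₀ * ⟪G (u (k + 1)), G v⟫) ≤ ν₀ * (‖G (u (k + 1))‖ * ‖G v‖) := by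
      rw [← mul_neg]
      exact mul_le_mul_of_nonneg_left ((neg_le_abs _).trans (abs_real_inner_le_norm _ _))
        hν₀_pos.le
    have hrot : 2 * νr * ⟪r (w k), (v : H)⟫ ≤ 2 * νr * (‖G (w k)‖ * (CP * ‖G v‖)) := by
      refine mul_le_mul_of_nonneg_left ?_ (by positivity)
      exact (real_inner_le_norm _ _).trans
        (mul_le_mul (hr _) (hP v) (norm_nonneg _) (norm_nonneg _))
    have hforce := inner_le_dualNorm_mul_s8 hP (f (k + 1)) v
    have hpsi : -⟪grd (ψ (k + 1) - ψ k), (v : H)⟫ ≤ ‖ψ (k + 1) - ψ k‖ * ‖G v‖ := by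
      rw [hibp, neg_neg]
      exact (real_inner_le_norm _ _).trans (mul_le_mul_of_nonneg_left (hd v) (norm_nonneg _))
    linarith
  have hsq : ∀ k ∈ Finset.range K, ‖ps k‖ ^ 2 ≤
      6 * (CP ^ 2 + ν₀ ^ 2 + (2 * νr * CP) ^ 2 + 1) / β ^ 2 *
        ((1 / τ) ^ 2 * ‖u (k + 1) - u k‖ ^ 2 + ‖G (u (k + 1))‖ ^ 2 + ‖G (w k)‖ ^ 2
          + dualNorm V G (f (k + 1)) ^ 2 + ‖ψ (k + 1) - ψ k‖ ^ 2
          + 𝔦 ^ 2 * (‖u k‖ ^ 2 * ‖G (u (k + 1))‖ ^ 2)) := by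
    intro k hk
    have h := (pow_le_pow_left₀ (by positivity) (hbound k (Finset.mem_range.1 hk)) 2).trans
      sq_sum_six_weighted_le
    rw [div_mul_eq_mul_div, le_div_iff₀ (by positivity)]
    linarith
  have hw : ∑ k ∈ Finset.range K, ‖G (w k)‖ ^ 2 ≤ ∑ k ∈ Finset.Icc 0 K, ‖G (w k)‖ ^ 2 := by
    refine Finset.sum_le_sum_of_subset_of_nonneg (fun k hk => ?_) fun _ _ _ => by positivity
    exact Finset.mem_Icc.2 ⟨k.zero_le, (Finset.mem_range.1 hk).le⟩
  have hsum := mul_le_mul_of_nonneg_left (Finset.sum_le_sum hsq) hτ.le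
  rw [← Finset.mul_sum, mul_left_comm] at hsum
  refine hsum.trans (mul_le_mul_of_nonneg_left ?_ (by positivity))
  simp only [Finset.sum_Icc_one_eq_sum_range, Nat.add_sub_cancel, Finset.sum_add_distrib,
    ← Finset.mul_sum, mul_add]
  have hτ_sq : τ * ((1 / τ) ^ 2 * ∑ k ∈ Finset.range K, ‖u (k + 1) - u k‖ ^ 2)
      = (1 / τ) * ∑ k ∈ Finset.range K, ‖u (k + 1) - u k‖ ^ 2 := by
    field_simp
  rw [hτ_sq, mul_assoc τ (𝔦 ^ 2)]
  gcongr
end
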